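/- arXiv:1507.05454 — 2 statements merged into one kernel-verified Lean document; each statement's English description precedes it below -/
import Mathlib

section
/- Let A′ and A be atoms with A′ more general than A (A′ ≤ A), and let H be an atom with Var(H) ∩ Var(A) = ∅ and Var(H) ∩ Var(A′) = ∅. Suppose σ is a most general unifier of A and H and σ′ is a most general unifier of A′ and H. Then A′σ′ ≤ Aσ and Hσ′ ≤ Hσ; more generally, for every atom C with Var(C) ⊆ Var(H) we have Cσ′ ≤ Cσ (i.e., σ′ is more general than σ when restricted to the variables of H). -/
/- A model of first-order terms/atoms (atoms are modeled as terms with a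
distinguished top symbol) and finitely supported substitutions, following
the standard conventions of logic programming. -/

namespace Concolic

open FirstOrder Language

variable {L : FirstOrder.Language} {V : Type} [DecidableEq V]

/-- A substitution: a map from variables to terms (the finite-support
condition is stated separately as `IsSubst`). -/
abbrev Subst (L : FirstOrder.Language) (V : Type) : Type _ := V → L.Term V

/-- The domain of a substitution: the variables it moves. -/
def dom (σ : Subst L V) : Set V := {x | σ x ≠ Term.var x}

/-- The set of variables of a term (or atom). -/
def vars (t : L.Term V) : Set V := ↑t.varFinset

/-- The range of a substitution: variables occurring in images of its domain. -/
def ran (σ : Subst L V) : Set V := ⋃ x ∈ dom σ, vars (σ x)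

/-- Var(θ) = Dom(θ) ∪ Ran(θ). -/
def varsSubst (σ : Subst L V) : Set V := dom σ ∪ ran σ

/-- Composition of substitutions: `comp θ η` applies θ first, then η. -/
def comp (θ η : Subst L V) : Subst L V := fun x => (θ x).subst η

/-- A substitution is finitely supported: identity on all but finitely many variables. -/
def IsSubst (σ : Subst L V) : Prop := (dom σ).Finite

/-- θ is idempotent if θθ = θ. -/
def Idempotent (σ : Subst L V) : Prop := comp σ σ = σ

/-- The substitution {X/t} mapping X to t and every other variable to itself. -/
def single (X : V) (t : L.Term V) : Subst L V := fun y => if y = X then t else Term.var y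

/-- Atoms A and B are unifiable if Aσ = Bσ for some substitution σ. -/
def Unifiable (A B : L.Term V) : Prop := ∃ σ : Subst L V, IsSubst σ ∧ A.subst σ = B.subst σ

/-- s₁ is more general than s₂ (s₁ ≤ s₂) if s₁θ = s₂ for some substitution θ. -/
def MoreGen (s₁ s₂ : L.Term V) : Prop := ∃ σ : Subst L V, IsSubst σ ∧ s₁.subst σ = s₂

/-- σ is a most general unifier of A and H. -/
def IsMGU (σ : Subst L V) (A H : L.Term V) : Prop :=
  IsSubst σ ∧ A.subst σ = H.subst σ ∧
    ∀ θ : Subst L V, IsSubst θ → A.subst θ = H.subst θ →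
      ∃ δ : Subst L V, IsSubst δ ∧ θ = comp σ δ

/-- The variables of a set of atoms. -/
def varsSet (𝓑 : Set (L.Term V)) : Set V := ⋃ B ∈ 𝓑, vars B

/-- A term is ground if it contains no variables. -/
def Ground (t : L.Term V) : Prop := t.varFinset = ∅

end Concolic

namespace Concolic

/-- Substituting along a composition is substituting twice. -/
theorem subst_comp {L : FirstOrder.Language} {V : Type} (t : L.Term V) (θ η : Subst L V) :
    t.subst (comp θ η) = (t.subst θ).subst η := by
  induction t with
  | var x => rfl
  | func f ts ih => simp only [FirstOrder.Language.Term.subst, ih]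

/-- Substitutions agreeing on the variables of a term act equally on it. -/
theorem subst_congr {L : FirstOrder.Language} {V : Type} [DecidableEq V] (t : L.Term V)
    {θ η : Subst L V} (h : ∀ x ∈ vars t, θ x = η x) : t.subst θ = t.subst η := by
  induction t with
  | var x => exact h x (by simp [vars, FirstOrder.Language.Term.varFinset])
  | func f ts ih =>
    simp only [FirstOrder.Language.Term.subst, FirstOrder.Language.Term.func.injEq, heq_eq_eq,
      true_and]
    funext i
    refine ih i fun x hx => h x ?_
    simp only [vars, FirstOrder.Language.Term.varFinset, Finset.mem_coe, Finset.mem_biUnion,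
      Finset.mem_univ, true_and] at hx ⊢
    exact ⟨i, hx⟩

/-- If A′ ≤ A, H is variable disjoint with A and A′, σ is an mgu of
A and H and σ′ an mgu of A′ and H, then A′σ′ ≤ Aσ, Hσ′ ≤ Hσ, and Cσ′ ≤ Cσ for
every atom C with Var(C) ⊆ Var(H). -/
theorem stmt2 {L : FirstOrder.Language} {V : Type} [DecidableEq V]
    (A' A H : L.Term V)
    (hgen : MoreGen A' A)
    (h1 : vars H ∩ vars A = ∅) (h2 : vars H ∩ vars A' = ∅)
    (σ σ' : Subst L V)
    (hσ : IsMGU σ A H) (hσ' : IsMGU σ' A' H) :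
    MoreGen (A'.subst σ') (A.subst σ) ∧ MoreGen (H.subst σ') (H.subst σ) ∧
      ∀ C : L.Term V, vars C ⊆ vars H → MoreGen (C.subst σ') (C.subst σ) := by
  classical
  obtain ⟨ρ, -, rfl⟩ := hgen
  obtain ⟨hσfin, hunif, -⟩ := hσ
  let θ : Subst L V := fun x => if x ∈ vars A' then comp ρ σ x else σ x
  have hθA : A'.subst θ = (A'.subst ρ).subst σ := by
    rw [← subst_comp]
    exact subst_congr A' fun x hx => if_pos hx
  have hθ : ∀ C : L.Term V, vars C ⊆ vars H → C.subst θ = C.subst σ := fun C hC =>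
    subst_congr C fun x hx => if_neg fun hx' =>
      Set.notMem_empty x (h2 ▸ (⟨hC hx, hx'⟩ : x ∈ vars H ∩ vars A'))
  have hθfin : IsSubst θ := by
    refine (A'.varFinset.finite_toSet.union hσfin).subset fun x hx => ?_
    by_cases hxA : x ∈ vars A'
    · exact Or.inl hxA
    · refine Or.inr fun hx' => hx ?_
      rw [← hx']
      exact if_neg hxA
  obtain ⟨δ, hδ, hcomp⟩ := hσ'.2.2 θ hθfin (by rw [hθA, hunif, hθ H subset_rfl])
  have hgenH : ∀ C : L.Term V, vars C ⊆ vars H → MoreGen (C.subst σ') (C.subst σ) :=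
    fun C hC => ⟨δ, hδ, by rw [← subst_comp, ← hcomp, hθ C hC]⟩
  exact ⟨⟨δ, hδ, by rw [← subst_comp, ← hcomp, hθA]⟩, hgenH H subset_rfl, hgenH⟩

end Concolic
end

section
/- Let 𝓑 be a finite set of atoms, X a variable with X ∈ Var(𝓑), and t a term with Var(t) ⊆ Var(𝓑) and X ∉ Var(t); let η = {X/t} and let 𝓑η = {Bη : B ∈ 𝓑}. If A′ is an atom, B ∈ 𝓑, and θ is a substitution with A′θ = Bθ and Var(𝓑) ∩ Dom(θ) = ∅, then A′(θη) = (Bη)(θη) and Var(𝓑η) ∩ Dom(θη) = ∅. (This is the preservation, under one variable-elimination step of the maximal-unifying-substitution algorithm, of the invariant: for each atom A′ of the input there exist B ∈ 𝓑 and a substitution θ with A′θ = Bθ and Var(𝓑) ∩ Dom(θ) = ∅.) -/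
namespace Concolic

section

open FirstOrder Language

variable {L : FirstOrder.Language} {V : Type}

theorem subst_subst (t : L.Term V) (σ τ : Subst L V) :
    (t.subst σ).subst τ = t.subst (comp σ τ) := by
  induction t with
  | var x => rfl
  | func f ts ih => simp [Term.subst, ih]

variable [DecidableEq V]

theorem vars_var (x : V) : vars (Term.var x : L.Term V) = {x} := by
  simp [vars]

theorem vars_func {n : ℕ} (f : L.Functions n) (ts : Fin n → L.Term V) :
    vars (Term.func f ts) = ⋃ i, vars (ts i) := by
  simp [vars]

theorem subst_eq_self {t : L.Term V} {σ : Subst L V} (h : ∀ x ∈ vars t, σ x = Term.var x) :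
    t.subst σ = t := by
  induction t with
  | var x => exact h x (by simp [vars_var])
  | func f ts ih =>
    simp only [Term.subst, Term.func.injEq, heq_eq_eq, true_and]
    funext i
    exact ih i fun x hx => h x (by rw [vars_func]; exact Set.mem_iUnion_of_mem i hx)

theorem vars_subst (t : L.Term V) (σ : Subst L V) :
    vars (t.subst σ) = ⋃ x ∈ vars t, vars (σ x) := by
  induction t with
  | var x => simp [vars_var, Term.subst]
  | func f ts ih => simp only [Term.subst, vars_func, ih, Set.biUnion_iUnion]

theorem single_of_ne {X y : V} (t : L.Term V) (h : y ≠ X) : single X t y = Term.var y :=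
  if_neg h

theorem vars_subst_single_subset {X : V} {t : L.Term V} (hXt : X ∉ vars t) (C : L.Term V) :
    vars (C.subst (single X t)) ⊆ (vars C ∪ vars t) \ {X} := by
  intro v hv
  simp only [vars_subst, Set.mem_iUnion] at hv
  obtain ⟨x, hx, hv⟩ := hv
  by_cases h : x = X
  · rw [single, if_pos h] at hv
    exact ⟨Or.inr hv, fun hvX => hXt (hvX ▸ hv)⟩
  · rw [single_of_ne t h, vars_var] at hv
    obtain rfl := hv
    exact ⟨Or.inl hx, h⟩

end

/-- preservation of the invariant under one variable-elimination
step η = {X/t} of the maximal-unifying-substitution algorithm. -/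
theorem stmt3 {L : FirstOrder.Language} {V : Type} [DecidableEq V]
    (𝓑 : Set (L.Term V)) (hfin : 𝓑.Finite)
    (X : V) (hX : X ∈ varsSet 𝓑) (t : L.Term V)
    (ht : vars t ⊆ varsSet 𝓑) (hXt : X ∉ vars t)
    (A' B : L.Term V) (hB : B ∈ 𝓑)
    (θ : Subst L V) (hθfin : IsSubst θ)
    (hunif : A'.subst θ = B.subst θ)
    (hdisj : varsSet 𝓑 ∩ dom θ = ∅) :
    A'.subst (comp θ (single X t))
        = (B.subst (single X t)).subst (comp θ (single X t)) ∧
      varsSet ((fun C => C.subst (single X t)) '' 𝓑) ∩ dom (comp θ (single X t)) = ∅ := by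
  have hsub : ∀ C ∈ 𝓑, vars C ⊆ varsSet 𝓑 := fun C hC => Set.subset_biUnion_of_mem hC
  have hθ : ∀ x ∈ varsSet 𝓑, θ x = .var x := fun x hx => by
    by_contra h
    exact (Set.eq_empty_iff_forall_notMem.mp hdisj x) ⟨hx, h⟩
  have hfix : ∀ C ∈ 𝓑, ∀ x ∈ vars (C.subst (single X t)),
      comp θ (single X t) x = .var x := fun C hC x hx => by
    obtain ⟨hx, hxX⟩ := vars_subst_single_subset hXt C hx
    rw [comp, hθ x (hx.elim (fun h => hsub C hC h) (fun h => ht h))]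
    exact single_of_ne t hxX
  constructor
  · rw [subst_eq_self (hfix B hB), ← subst_subst, hunif,
      subst_eq_self fun x hx => hθ x (hsub B hB hx)]
  · refine Set.eq_empty_iff_forall_notMem.mpr fun x ⟨hx, hxd⟩ => ?_
    simp only [varsSet, Set.mem_iUnion, Set.mem_image] at hx
    obtain ⟨_, ⟨C, hC, rfl⟩, hx⟩ := hx
    exact hxd (hfix C hC x hx)

end Concolic
end
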